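/- Let h : ℝ → ℝ be differentiable. Define u(x,t) = (1 − x·t)⁻¹ · h( x/(1 − x·t) ) for all (x,t) with x·t ≠ 1. Then u(x,0) = h(x) for all x, and at every point (x,t) with x·t ≠ 1, the partial derivative of u with respect to t equals x·u(x,t) + x²·(partial derivative of u with respect to x); that is, u solves the PDE ∂u/∂t = x·u + x²·∂u/∂x with initial condition u(·,0) = h. -/

import Mathlib

/-- Let `h : ℝ → ℝ` be differentiable and `u x t = (1 - x·t)⁻¹ · h (x / (1 - x·t))`.
Then `u x 0 = h x` and, wherever `x·t ≠ 1`,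
`∂u/∂t = x·u + x²·∂u/∂x`. -/
theorem pascal_pde_solution (h : ℝ → ℝ) (hh : Differentiable ℝ h)
    (u : ℝ → ℝ → ℝ)
    (hu : ∀ x t, u x t = (1 - x * t)⁻¹ * h (x / (1 - x * t))) :
    (∀ x, u x 0 = h x) ∧
    (∀ x t, x * t ≠ 1 →
      deriv (fun s => u x s) t = x * u x t + x ^ 2 * deriv (fun y => u y t) x) := by
  refine ⟨fun x => by simp [hu], fun x t hxt => ?_⟩
  have hd : 1 - x * t ≠ 0 := sub_ne_zero.mpr hxt.symm
  have hh' := (hh (x / (1 - x * t))).hasDerivAt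
  have denom_t : HasDerivAt (fun s => 1 - x * s) (-x) t := by
    simpa using ((hasDerivAt_id t).const_mul x).const_sub 1
  have denom_x : HasDerivAt (fun y => 1 - y * t) (-t) x := by
    simpa using ((hasDerivAt_id x).mul_const t).const_sub 1
  have deriv_t := (denom_t.fun_inv hd).fun_mul
    (HasDerivAt.comp t hh' ((hasDerivAt_const t x).fun_div denom_t hd))
  have deriv_x := (denom_x.fun_inv hd).fun_mul
    (HasDerivAt.comp x hh' ((hasDerivAt_id' x).fun_div denom_x hd))
  simp only [Function.comp_apply] at deriv_t deriv_x
  simp only [hu]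
  rw [deriv_t.deriv, deriv_x.deriv]
  generalize deriv h (x / (1 - x * t)) = b
  generalize h (x / (1 - x * t)) = a
  field_simp
  ring
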